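/- Let β ∈ ℝ and δ = 0. The function z ↦ (z+β)²·F_{β,0}(z) extends to an analytic function H on an open neighborhood of z₀ := −β, and the residue of F_{β,0} at z₀, namely H′(−β), equals 2 q^{β/2} ln(q^{−1}−q) / ((1−q²)^β (ln q)²). In particular F_{β,0} has at z₀ = −β a pole of order at most 2. -/

import Mathlib

open Complex Real Filter Finset Topology

/-- The q-number `[x]_q = (q^x - q^{-x})/(q - q⁻¹)`. -/
noncomputable def qnum (q x : ℝ) : ℝ := (q ^ x - q ^ (-x)) / (q - q⁻¹)

/-- For a positive real `a` and `w : ℂ`, `a^w := exp(w · ln a)`. -/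
noncomputable def rcpow (a : ℝ) (w : ℂ) : ℂ := Complex.exp (w * (Real.log a : ℂ))

/-- The `(n,j)`-term of the q-zeta double series, corresponding to
`l = n + 1/2` and `k = j - n - 1/2`: `q^{βl+δk} · [l+1/2]_q^{-z}`. -/
noncomputable def qzetaTerm (q β δ : ℝ) (z : ℂ) (n j : ℕ) : ℂ :=
  ((q ^ (β * ((n : ℝ) + 1/2) + δ * ((j : ℝ) - (n : ℝ) - 1/2)) : ℝ) : ℂ) *
    rcpow (qnum q ((n : ℝ) + 1)) (-z)

/-- The q-zeta function `ζ_{β,δ}(z)` as a double series. -/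
noncomputable def qzeta (q β δ : ℝ) (z : ℂ) : ℂ :=
  ∑' n : ℕ, ∑ j ∈ Finset.range (2 * n + 2), qzetaTerm q β δ z n j

/-- The generalized binomial coefficient `C(z+j-1, j) = (1/j!)·∏_{i=0}^{j-1}(z+i)`. -/
noncomputable def binomC (z : ℂ) (j : ℕ) : ℂ :=
  (∏ i ∈ Finset.range j, (z + (i : ℂ))) / (Nat.factorial j : ℂ)

/-- The `j`-th term of the series defining `F_{β,δ}(z)`. -/
noncomputable def Fterm (q β δ : ℝ) (z : ℂ) (j : ℕ) : ℂ :=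
  binomC z j * (q : ℂ) ^ (2 * j) /
    ((1 - rcpow q (((β - δ + 2 * (j : ℝ)) : ℝ) + z)) *
     (1 - rcpow q (((β + δ + 2 * (j : ℝ)) : ℝ) + z)))

/-- The meromorphic continuation `F_{β,δ}`. -/
noncomputable def Ffun (q β δ : ℝ) (z : ℂ) : ℂ :=
  ((q ^ (β / 2) * (q ^ (-δ / 2) + q ^ (δ / 2)) : ℝ) : ℂ) * rcpow (1 - q ^ 2) z *
    ∑' j : ℕ, Fterm q β δ z j

lemma exists_entire_factor (L : ℂ) : ∃ g : ℂ → ℂ, Differentiable ℂ g ∧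
    (∀ w, 1 - Complex.exp (w * L) = w * g w) ∧ g 0 = -L ∧ deriv g 0 = -L ^ 2 / 2 := by
  have hf : ∀ w, HasDerivAt (fun w : ℂ => 1 - Complex.exp (w * L))
      (-(L * Complex.exp (w * L))) w := by
    intro w
    have h := (((hasDerivAt_id w).mul_const L).cexp).const_sub 1
    simpa [mul_comm] using h
  set f : ℂ → ℂ := fun w => 1 - Complex.exp (w * L) with hfdef
  have hg : Differentiable ℂ (dslope f 0) := by
    rw [← differentiableOn_univ, Complex.differentiableOn_dslope univ_mem]
    exact fun w _ => (hf w).differentiableAt.differentiableWithinAt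
  have hfac : ∀ w, f w = w * dslope f 0 w := by
    intro w
    have h := sub_smul_dslope f 0 w
    simp only [sub_zero, smul_eq_mul] at h
    rw [h]
    simp [hfdef]
  refine ⟨dslope f 0, hg, hfac, ?_, ?_⟩
  · rw [dslope_same, (hf 0).deriv]
    simp
  · set g := dslope f 0
    have hg' : Differentiable ℂ (deriv g) := fun w =>
      (hg.analyticAt w).deriv.differentiableAt
    have hderiv : (fun w => g w + w * deriv g w) = fun w => -(L * Complex.exp (w * L)) := by
      funext w
      have h := (hasDerivAt_id w).mul (hg w).hasDerivAt
      have h2 : HasDerivAt f (1 * g w + w * deriv g w) w :=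
        h.congr_of_eventuallyEq (Eventually.of_forall hfac)
      rw [← h2.unique (hf w), one_mul]
    have h1 : HasDerivAt (fun w => g w + w * deriv g w)
        (deriv g 0 + (1 * deriv g 0 + 0 * deriv (deriv g) 0)) 0 :=
      (hg 0).hasDerivAt.add ((hasDerivAt_id (0 : ℂ)).mul (hg' 0).hasDerivAt)
    have h2 : HasDerivAt (fun w => -(L * Complex.exp (w * L))) (-(L * L)) 0 := by
      have h := ((((hasDerivAt_id (0 : ℂ)).mul_const L).cexp).const_mul L).fun_neg
      simpa using h
    rw [← hderiv] at h2
    linear_combination (h1.unique h2) / 2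

lemma norm_binomC_le {z : ℂ} {k : ℕ} (hz : ‖z‖ ≤ k + 1) (j : ℕ) :
    ‖binomC z j‖ ≤ ((j + k).choose k : ℝ) := by
  have hfac : (0 : ℝ) < (j.factorial : ℝ) := by positivity
  rw [binomC, norm_div, Complex.norm_natCast, div_le_iff₀ hfac, norm_prod]
  calc ∏ i ∈ Finset.range j, ‖z + (i : ℂ)‖
      ≤ ∏ i ∈ Finset.range j, ((k + 1 + i : ℕ) : ℝ) := by
        refine Finset.prod_le_prod (fun _ _ => norm_nonneg _) fun i _ => ?_
        refine (norm_add_le _ _).trans ?_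
        rw [Complex.norm_natCast]
        push_cast
        linarith
    _ = ((j + k).choose k : ℝ) * (j.factorial : ℝ) := by
        rw [← Nat.cast_prod, ← Nat.ascFactorial_eq_prod_range,
          Nat.ascFactorial_eq_factorial_mul_choose,
          add_comm j k, Nat.choose_symm_add]
        push_cast
        ring

lemma norm_rcpow (a : ℝ) (w : ℂ) : ‖rcpow a w‖ = Real.exp (w.re * Real.log a) := by
  simp [rcpow, Complex.norm_exp]

lemma differentiable_rcpow (a : ℝ) : Differentiable ℂ (rcpow a) := by
  unfold rcpow
  fun_prop

lemma differentiable_binomC (j : ℕ) : Differentiable ℂ fun z => binomC z j := by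
  unfold binomC
  fun_prop

lemma one_sub_le_norm_one_sub_rcpow {q : ℝ} (hq0 : 0 < q) (hq1 : q < 1) {w : ℂ}
    (hw : 1 ≤ w.re) : 1 - q ≤ ‖1 - rcpow q w‖ := by
  have h : ‖rcpow q w‖ ≤ q := by
    rw [norm_rcpow]
    calc Real.exp (w.re * Real.log q) ≤ Real.exp (Real.log q) :=
          Real.exp_le_exp.2 (by nlinarith [Real.log_neg hq0 hq1])
      _ = q := Real.exp_log hq0
  have h2 := norm_sub_norm_le (1 : ℂ) (rcpow q w)
  rw [norm_one] at h2
  linarith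

lemma one_le_re_exponent {β : ℝ} {z : ℂ} (hz : ‖z + β‖ < 1) {j : ℕ} (hj : 1 ≤ j) :
    1 ≤ (((β + 2 * (j : ℝ) : ℝ) : ℂ) + z).re := by
  have h := (abs_le.1 ((Complex.abs_re_le_norm (z + β)).trans hz.le)).1
  have hj' : (1 : ℝ) ≤ j := by exact_mod_cast hj
  simp only [Complex.add_re, Complex.ofReal_re] at h ⊢
  linarith

lemma norm_Fterm_succ_le {q β : ℝ} (hq0 : 0 < q) (hq1 : q < 1) {z : ℂ} {k : ℕ}
    (hz : ‖z + β‖ < 1) (hk : ‖z‖ ≤ k + 1) (j : ℕ) :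
    ‖Fterm q β 0 z (j + 1)‖ ≤
      ((j + 1 + k).choose k : ℝ) * (q ^ 2) ^ (j + 1) / (1 - q) ^ 2 := by
  have hd := one_sub_le_norm_one_sub_rcpow hq0 hq1 (one_le_re_exponent hz (Nat.le_add_left 1 j))
  have hpos : 0 < 1 - q := by linarith
  rw [Fterm, sub_zero, add_zero, norm_div, norm_mul, norm_mul, norm_pow, Complex.norm_real,
    Real.norm_of_nonneg hq0.le, pow_mul, ← sq]
  gcongr
  exact norm_binomC_le hk _

lemma summable_choose_mul_pow_succ {q : ℝ} (hq0 : 0 < q) (hq1 : q < 1) (k : ℕ) :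
    Summable fun j : ℕ => ((j + 1 + k).choose k : ℝ) * (q ^ 2) ^ (j + 1) / (1 - q) ^ 2 := by
  have hq2 : ‖q ^ 2‖ < 1 := by
    rw [Real.norm_of_nonneg (by positivity)]
    nlinarith
  have h := summable_choose_mul_geometric_of_norm_lt_one k hq2
  exact (h.comp_injective (add_left_injective 1)).div_const _

lemma exists_nat_norm_le_of_norm_add_lt_one (β : ℝ) :
    ∃ k : ℕ, ∀ z : ℂ, ‖z + β‖ < 1 → ‖z‖ ≤ k + 1 := by
  obtain ⟨k, hk⟩ := exists_nat_ge |β|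
  refine ⟨k, fun z hz => ?_⟩
  have h := norm_sub_le (z + β) (β : ℂ)
  rw [add_sub_cancel_right, Complex.norm_real, Real.norm_eq_abs] at h
  linarith

lemma summable_Fterm {q β : ℝ} (hq0 : 0 < q) (hq1 : q < 1) {z : ℂ} (hz : ‖z + β‖ < 1) :
    Summable (Fterm q β 0 z) := by
  obtain ⟨k, hk⟩ := exists_nat_norm_le_of_norm_add_lt_one β
  exact (summable_nat_add_iff 1).1 <| Summable.of_norm_bounded
    (summable_choose_mul_pow_succ hq0 hq1 k) (norm_Fterm_succ_le hq0 hq1 hz (hk z hz))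

lemma isOpen_norm_add_lt_one (β : ℝ) : IsOpen {z : ℂ | ‖z + β‖ < 1} :=
  isOpen_lt (by fun_prop) continuous_const

lemma differentiableOn_tsum_Fterm_succ {q : ℝ} (hq0 : 0 < q) (hq1 : q < 1) (β : ℝ) :
    DifferentiableOn ℂ (fun z => ∑' j : ℕ, Fterm q β 0 z (j + 1)) {z : ℂ | ‖z + β‖ < 1} := by
  obtain ⟨k, hk⟩ := exists_nat_norm_le_of_norm_add_lt_one β
  refine differentiableOn_tsum_of_summable_norm (summable_choose_mul_pow_succ hq0 hq1 k)
    (fun j z hz => ?_) (isOpen_norm_add_lt_one β)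
    fun j z hz => norm_Fterm_succ_le hq0 hq1 hz (hk z hz) j
  have hne : 1 - rcpow q (((β + 2 * ((j + 1 : ℕ) : ℝ) : ℝ) : ℂ) + z) ≠ 0 := by
    rw [← norm_pos_iff]
    have := one_sub_le_norm_one_sub_rcpow hq0 hq1 (one_le_re_exponent hz (Nat.le_add_left 1 j))
    linarith
  have hden : DifferentiableAt ℂ
      (fun z => 1 - rcpow q (((β + 2 * ((j + 1 : ℕ) : ℝ) : ℝ) : ℂ) + z)) z := by
    have := differentiable_rcpow q
    fun_prop
  simp only [Fterm, sub_zero, add_zero]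
  exact (((differentiable_binomC (j + 1) z).mul_const _).div (hden.mul hden)
    (mul_ne_zero hne hne)).differentiableWithinAt

theorem statement5 (q : ℝ) (hq0 : 0 < q) (hq1 : q < 1) (β : ℝ) :
    ∃ (U : Set ℂ) (H : ℂ → ℂ), IsOpen U ∧ ((-β : ℝ) : ℂ) ∈ U ∧
      AnalyticOn ℂ H U ∧
      (∀ z ∈ U, z ≠ ((-β : ℝ) : ℂ) → H z = (z + (β : ℂ)) ^ 2 * Ffun q β 0 z) ∧
      deriv H ((-β : ℝ) : ℂ) =
        ((2 * q ^ (β / 2) * Real.log (q⁻¹ - q) /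
          ((1 - q ^ 2) ^ β * (Real.log q) ^ 2) : ℝ) : ℂ) := by
  have hL : Real.log q < 0 := Real.log_neg hq0 hq1
  have hLc : (Real.log q : ℂ) ≠ 0 := by exact_mod_cast hL.ne
  obtain ⟨g, hg, hfac, hg0, hg'⟩ := exists_entire_factor (Real.log q : ℂ)
  set V : Set ℂ := {z | ‖z + β‖ < 1} with hV
  set S : ℂ → ℂ := fun z => ∑' j : ℕ, Fterm q β 0 z (j + 1) with hS
  have hSd : DifferentiableOn ℂ S V := differentiableOn_tsum_Fterm_succ hq0 hq1 β
  set A : ℂ := ((q ^ (β / 2) * (q ^ (-(0 : ℝ) / 2) + q ^ ((0 : ℝ) / 2)) : ℝ) : ℂ) with hA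
  have hgβ : Differentiable ℂ fun z : ℂ => g (z + β) := by fun_prop
  have hVo : IsOpen V := isOpen_norm_add_lt_one β
  have hUo : IsOpen (V ∩ {z | g (z + β) ≠ 0}) :=
    hVo.inter (isOpen_ne_fun hgβ.continuous continuous_const)
  have hmemV : ((-β : ℝ) : ℂ) ∈ V := by simp [hV]
  refine ⟨V ∩ {z | g (z + β) ≠ 0},
    fun z => A * rcpow (1 - q ^ 2) z * ((g (z + β) ^ 2)⁻¹ + (z + β) ^ 2 * S z),
    hUo, ⟨hmemV, by simp [hg0, hL.ne]⟩, ?_, ?_, ?_⟩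
  · refine (DifferentiableOn.analyticOnNhd ?_ hUo).analyticOn
    refine ((differentiable_rcpow _).const_mul A).differentiableOn.mul (.add ?_ ?_)
    · exact (hgβ.pow 2).differentiableOn.inv fun z hz => pow_ne_zero 2 hz.2
    · exact (by fun_prop : Differentiable ℂ fun z : ℂ => (z + β) ^ 2).differentiableOn.mul
        (hSd.mono Set.inter_subset_left)
  · rintro z ⟨hzV, hgz⟩ hz
    have hzβ : z + β ≠ 0 := fun h => hz (by push_cast; linear_combination h)
    have hF0 : Fterm q β 0 z 0 = ((z + β) ^ 2 * g (z + β) ^ 2)⁻¹ := by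
      have h : 1 - rcpow q (((β + 2 * ((0 : ℕ) : ℝ) : ℝ) : ℂ) + z) = (z + β) * g (z + β) := by
        rw [← hfac, rcpow, Nat.cast_zero, mul_zero, add_zero, add_comm z]
      rw [Fterm, sub_zero, add_zero, h, ← sq, mul_pow]
      simp [binomC]
    rw [Ffun, (summable_Fterm hq0 hq1 hzV).tsum_eq_zero_add, hF0]
    simp only [hA, hS]
    have hgz' : g (z + β) ≠ 0 := hgz
    field_simp
  · have hz0 : ((-β : ℝ) : ℂ) + β = 0 := by push_cast; ring
    set z₀ : ℂ := ((-β : ℝ) : ℂ) with hz₀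
    have hadd : HasDerivAt (fun z : ℂ => z + β) 1 z₀ := (hasDerivAt_id z₀).add_const _
    have hgd : HasDerivAt (fun z : ℂ => g (z + β)) (-(Real.log q : ℂ) ^ 2 / 2) z₀ := by
      have h : HasDerivAt g (-(Real.log q : ℂ) ^ 2 / 2) (z₀ + β) := by
        rw [hz0, ← hg']
        exact (hg 0).hasDerivAt
      simpa using! h.comp z₀ hadd
    have hne : g (z₀ + β) ^ 2 ≠ 0 := by
      rw [hz0, hg0]
      exact pow_ne_zero 2 (neg_ne_zero.2 hLc)
    have hSz : HasDerivAt S (deriv S z₀) z₀ :=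
      (hSd.differentiableAt (hVo.mem_nhds hmemV)).hasDerivAt
    have hr : HasDerivAt (rcpow (1 - q ^ 2))
        (rcpow (1 - q ^ 2) z₀ * (Real.log (1 - q ^ 2) : ℂ)) z₀ := by
      have h := ((hasDerivAt_id z₀).mul_const (Real.log (1 - q ^ 2) : ℂ)).cexp
      rw [id_eq, one_mul] at h
      exact h
    have hH := (hr.const_mul A).mul (((hgd.pow 2).inv hne).add ((hadd.pow 2).mul hSz))
    refine hH.deriv.trans ?_
    have hq2 : 0 < 1 - q ^ 2 := by nlinarith
    have hlog : Real.log (q⁻¹ - q) = Real.log (1 - q ^ 2) - Real.log q := by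
      rw [← Real.log_div hq2.ne' hq0.ne']
      congr 1
      field_simp
    have hrz : rcpow (1 - q ^ 2) z₀ = (((1 - q ^ 2) ^ β)⁻¹ : ℝ) := by
      rw [← Real.rpow_neg hq2.le, Real.rpow_def_of_pos hq2, rcpow, hz₀]
      push_cast
      ring_nf
    have hAv : A = ((2 * q ^ (β / 2) : ℝ) : ℂ) := by
      rw [hA]
      congr 1
      norm_num
      ring
    have hpow : (((1 - q ^ 2) ^ β : ℝ) : ℂ) ≠ 0 := by
      exact_mod_cast (Real.rpow_pos_of_pos hq2 β).ne'
    simp only [Pi.pow_apply, Pi.inv_apply, Pi.add_apply, Pi.mul_apply, hz0, hg0]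
    rw [hlog, hrz, hAv]
    push_cast at hpow ⊢
    field_simp
    ring
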